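/- Let f : ℝ^n → ℝ ∪ {+∞} be μ_f-strongly convex proper closed, g : ℝ^m → ℝ ∪ {+∞} proper closed convex, A ∈ ℝ^{m×n}, and M1 symmetric positive definite. If (z, y, u) ∈ ℝ^m × ℝ^n × ℝ^n satisfies ∇f*(y) = M1^{-1}u, then L(z, y, u) ≥ g*(z) + f*(−A^T z) + ½‖A^T z + y‖²_{M1^{-1}} − (1/(2μ_f)) ‖A^T z + y‖², where L(z,y,u) = g*(z) + f*(y) + ⟨−A^T z − y, M1^{-1} u⟩ + ½‖A^T z + y‖²_{M1^{-1}}. -/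

import Mathlib

open Matrix Filter

noncomputable section

/-- Euclidean norm of a vector. -/
def nrm {ι : Type*} [Fintype ι] (x : ι → ℝ) : ℝ := Real.sqrt (x ⬝ᵥ x)

/-- A function into the extended reals is proper: never `⊥` and somewhere finite. -/
def ProperE {ι : Type*} (f : (ι → ℝ) → EReal) : Prop :=
  (∃ x, f x ≠ ⊤) ∧ ∀ x, f x ≠ ⊥

/-- Convexity of an extended-real-valued function. -/
def ConvexE {ι : Type*} (f : (ι → ℝ) → EReal) : Prop :=
  ∀ x y : ι → ℝ, ∀ t : ℝ, 0 ≤ t → t ≤ 1 →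
    f (t • x + (1 - t) • y) ≤ (t : EReal) * f x + ((1 - t : ℝ) : EReal) * f y

/-- `μ`-strong convexity of an extended-real-valued function. -/
def StrongConvexE {ι : Type*} [Fintype ι] (μ : ℝ) (f : (ι → ℝ) → EReal) : Prop :=
  ∀ x y : ι → ℝ, ∀ t : ℝ, 0 ≤ t → t ≤ 1 →
    f (t • x + (1 - t) • y) + ((μ / 2 * (t * (1 - t)) * ((x - y) ⬝ᵥ (x - y)) : ℝ) : EReal) ≤
      (t : EReal) * f x + ((1 - t : ℝ) : EReal) * f y

/-- Fenchel conjugate. -/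
def conjE {ι : Type*} [Fintype ι] (f : (ι → ℝ) → EReal) (y : ι → ℝ) : EReal :=
  ⨆ x : ι → ℝ, ((x ⬝ᵥ y : ℝ) : EReal) - f x

/-- `v` is a subgradient of `f` at `x`. -/
def SubgradAt {ι : Type*} [Fintype ι] (f : (ι → ℝ) → EReal) (x v : ι → ℝ) : Prop :=
  ∀ z, f x + (((z - x) ⬝ᵥ v : ℝ) : EReal) ≤ f z

/-- `p = prox^M_φ(x)`: `p` minimizes `φ(·) + ½‖· − x‖²_M`. -/
def IsProxPt {ι : Type*} [Fintype ι] (M : Matrix ι ι ℝ) (φ : (ι → ℝ) → EReal)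
    (x p : ι → ℝ) : Prop :=
  ∀ w, φ p + (((1 / 2 : ℝ) * ((p - x) ⬝ᵥ M.mulVec (p - x)) : ℝ) : EReal) ≤
       φ w + (((1 / 2 : ℝ) * ((w - x) ⬝ᵥ M.mulVec (w - x)) : ℝ) : EReal)

/-- Smallest eigenvalue of a symmetric matrix, via the Rayleigh quotient. -/
def lamMin {ι : Type*} [Fintype ι] (M : Matrix ι ι ℝ) : ℝ :=
  sInf {r | ∃ v : ι → ℝ, v ⬝ᵥ v = 1 ∧ r = v ⬝ᵥ M.mulVec v}

/-- Largest eigenvalue of a symmetric matrix, via the Rayleigh quotient. -/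
def lamMax {ι : Type*} [Fintype ι] (M : Matrix ι ι ℝ) : ℝ :=
  sSup {r | ∃ v : ι → ℝ, v ⬝ᵥ v = 1 ∧ r = v ⬝ᵥ M.mulVec v}

/-- Spectral (operator 2-) norm of a matrix. -/
def specNorm {ι κ : Type*} [Fintype ι] [Fintype κ] (A : Matrix ι κ ℝ) : ℝ :=
  sSup {r | ∃ v : κ → ℝ, v ⬝ᵥ v = 1 ∧ r = nrm (A.mulVec v)}

theorem conjE_ne_bot {ι : Type*} [Fintype ι] {f : (ι → ℝ) → EReal} (hf : ProperE f)
    (y : ι → ℝ) : conjE f y ≠ ⊥ := by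
  obtain ⟨⟨x, hx⟩, hbot⟩ := hf
  have h : ((x ⬝ᵥ y : ℝ) : EReal) - f x ≤ conjE f y :=
    le_iSup (fun x : ι → ℝ => ((x ⬝ᵥ y : ℝ) : EReal) - f x) x
  lift f x to ℝ using ⟨hx, hbot x⟩ with a
  intro hy
  rw [hy, ← EReal.coe_sub] at h
  exact EReal.coe_ne_bot _ (le_bot_iff.mp h)

theorem dotProduct_le_half_mul_add {ι : Type*} [Fintype ι] {k : ℝ} (hk : 0 < k) (p d : ι → ℝ) :
    p ⬝ᵥ d ≤ k / 2 * (p ⬝ᵥ p) + (d ⬝ᵥ d) / (2 * k) := by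
  have h : 0 ≤ (k • p - d) ⬝ᵥ (k • p - d) :=
    Finset.sum_nonneg fun i _ => mul_self_nonneg _
  simp only [sub_dotProduct, dotProduct_sub, smul_dotProduct, dotProduct_smul, smul_eq_mul,
    dotProduct_comm d p] at h
  have h2 : k / 2 * (p ⬝ᵥ p) + (d ⬝ᵥ d) / (2 * k) - p ⬝ᵥ d =
      (k * (k * (p ⬝ᵥ p) - p ⬝ᵥ d) - (k * (p ⬝ᵥ d) - d ⬝ᵥ d)) / (2 * k) := by
    field_simp
    ring
  have h3 := div_nonneg h (by positivity : 0 ≤ 2 * k)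
  linarith

/-- If `e` maximizes `⟨·, y⟩ - f` up to `ε`, then `f*` has a quadratic upper bound at `y`
with slope `e`, up to an error controlled by `ε`. -/
theorem StrongConvexE.conjE_le_of_near_maximizer {ι : Type*} [Fintype ι]
    {f : (ι → ℝ) → EReal} {μ : ℝ} (hμ : 0 < μ) (hbot : ∀ x, f x ≠ ⊥) (hf : StrongConvexE μ f)
    {y e : ι → ℝ} {c b ε t : ℝ} (hc : conjE f y ≤ c) (hb : f e = b) (hε : 0 ≤ ε)
    (he : c - ε ≤ e ⬝ᵥ y - b) (ht0 : 0 < t) (ht1 : t < 1) (w : ι → ℝ) :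
    conjE f w ≤ ((c + e ⬝ᵥ (w - y) +
      ((w - y) ⬝ᵥ (w - y)) / (2 * (μ * (1 - t))) + ε / t : ℝ) : EReal) := by
  refine iSup_le fun x => ?_
  by_cases hx : f x = ⊤
  · simp [hx]
  have hsc := hf x e t ht0.le ht1.le
  have hcp := (le_iSup (fun x : ι → ℝ => ((x ⬝ᵥ y : ℝ) : EReal) - f x)
    (t • x + (1 - t) • e)).trans hc
  have hpb := hbot (t • x + (1 - t) • e)
  have hxb := hbot x
  rw [hb] at hsc
  generalize f (t • x + (1 - t) • e) = q at hsc hcp hpb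
  generalize f x = a at hx hxb hsc ⊢
  lift a to ℝ using ⟨hx, hxb⟩
  have hq : q ≠ ⊤ := by
    rintro rfl
    rw [EReal.top_add_coe, ← EReal.coe_mul, ← EReal.coe_mul, ← EReal.coe_add, top_le_iff] at hsc
    exact EReal.coe_ne_top _ hsc
  lift q to ℝ using ⟨hq, hpb⟩
  norm_cast at hsc hcp ⊢
  have hk : 0 < μ * (1 - t) := mul_pos hμ (by linarith)
  have hy := dotProduct_le_half_mul_add hk (x - e) (w - y)
  simp only [add_dotProduct, smul_dotProduct, smul_eq_mul] at hcp
  have hbd : (1 - t) * b ≤ (1 - t) * (e ⬝ᵥ y - c + ε) :=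
    mul_le_mul_of_nonneg_left (by linarith) (by linarith)
  have hgap : x ⬝ᵥ y - c - a + μ * (1 - t) / 2 * ((x - e) ⬝ᵥ (x - e)) ≤ ε / t := by
    rw [le_div_iff₀ ht0]
    nlinarith [mul_nonneg ht0.le hε]
  have hsplit : x ⬝ᵥ w = x ⬝ᵥ y + e ⬝ᵥ (w - y) + (x - e) ⬝ᵥ (w - y) := by
    simp only [sub_dotProduct, dotProduct_sub]
    ring
  linarith

/-- The descent inequality for the conjugate of a strongly convex function. -/
theorem StrongConvexE.conjE_le_of_subgradAt {ι : Type*} [Fintype ι]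
    {f : (ι → ℝ) → EReal} {μ : ℝ} (hμ : 0 < μ) (hbot : ∀ x, f x ≠ ⊥) (hf : StrongConvexE μ f)
    {y v : ι → ℝ} {c : ℝ} (hc : conjE f y = c) (hv : SubgradAt (conjE f) y v) (w : ι → ℝ) :
    conjE f w ≤ ((c + (w - y) ⬝ᵥ v + 1 / (2 * μ) * ((w - y) ⬝ᵥ (w - y)) : ℝ) : EReal) := by
  have approx : ∀ t : ℝ, 0 < t → t < 1 → conjE f w ≤ ((c + (w - y) ⬝ᵥ v +
      (1 + t) * (((w - y) ⬝ᵥ (w - y)) / (2 * (μ * (1 - t)))) + (t ^ 2 + t) : ℝ) : EReal) := by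
    intro t ht0 ht1
    obtain ⟨e, he⟩ : ∃ e, ((c - t ^ 3 : ℝ) : EReal) < ((e ⬝ᵥ y : ℝ) : EReal) - f e := by
      rw [← lt_iSup_iff]
      change _ < conjE f y
      rw [hc, EReal.coe_lt_coe_iff]
      linarith [pow_pos ht0 3]
    have het : f e ≠ ⊤ := by
      intro h
      simp [h] at he
    obtain ⟨b, hb⟩ : ∃ b : ℝ, f e = b := ⟨_, (EReal.coe_toReal het (hbot e)).symm⟩
    rw [hb] at he
    norm_cast at he
    have bound := hf.conjE_le_of_near_maximizer hμ hbot hc.le hb (pow_pos ht0 3).le he.le ht0 ht1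
    refine (bound w).trans ?_
    have hback := (hv (y - t • (w - y))).trans (bound (y - t • (w - y)))
    rw [hc] at hback
    norm_cast at hback ⊢
    have hdir : y - t • (w - y) - y = -(t • (w - y)) := by abel
    rw [hdir] at hback
    generalize w - y = d at hback ⊢
    simp only [neg_dotProduct, dotProduct_neg, smul_dotProduct, dotProduct_smul, smul_eq_mul]
      at hback
    have hcube : t ^ 3 / t = t ^ 2 := by field_simp
    rw [hcube] at hback ⊢
    have hdiv : -(t * -(t * (d ⬝ᵥ d))) / (2 * (μ * (1 - t))) =
        t * (t * ((d ⬝ᵥ d) / (2 * (μ * (1 - t))))) := by ring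
    rw [hdiv] at hback
    have hslope : e ⬝ᵥ d ≤ d ⬝ᵥ v + t * ((d ⬝ᵥ d) / (2 * (μ * (1 - t)))) + t := by
      refine le_of_mul_le_mul_left ?_ ht0
      linarith
    linarith
  have hlim : Tendsto (fun t : ℝ => ((c + (w - y) ⬝ᵥ v +
      (1 + t) * (((w - y) ⬝ᵥ (w - y)) / (2 * (μ * (1 - t)))) + (t ^ 2 + t) : ℝ) : EReal))
      (nhdsWithin 0 (Set.Ioi 0))
      (nhds ((c + (w - y) ⬝ᵥ v + 1 / (2 * μ) * ((w - y) ⬝ᵥ (w - y)) : ℝ) : EReal)) := by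
    refine (continuous_coe_real_ereal.tendsto _).comp (tendsto_nhdsWithin_of_tendsto_nhds ?_)
    have hcont : ContinuousAt (fun t : ℝ => c + (w - y) ⬝ᵥ v +
        (1 + t) * (((w - y) ⬝ᵥ (w - y)) / (2 * (μ * (1 - t)))) + (t ^ 2 + t)) 0 := by
      have : 2 * (μ * (1 - (0 : ℝ))) ≠ 0 := by simp [hμ.ne']
      fun_prop (disch := assumption)
    convert hcont.tendsto using 2
    ring
  refine ge_of_tendsto hlim ?_
  filter_upwards [Ioo_mem_nhdsGT (zero_lt_one (α := ℝ))] with t ht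
  exact approx t ht.1 ht.2

/-- if `∇f*(y) = M1⁻¹u` (expressed through the subdifferential of `f*`),
then the generalized augmented Lagrangian satisfies
`L(z,y,u) ≥ g*(z) + f*(−Aᵀz) + ½‖Aᵀz + y‖²_{M1⁻¹} − (1/(2μ_f))‖Aᵀz + y‖²`. -/
theorem lagrangian_pointwise_lower_bound {n m : ℕ}
    (f : (Fin n → ℝ) → EReal) (g : (Fin m → ℝ) → EReal)
    (μ : ℝ) (hμ : 0 < μ)
    (hfp : ProperE f) (hfc : LowerSemicontinuous f) (hfsc : StrongConvexE μ f)
    (hgp : ProperE g) (hgc : LowerSemicontinuous g) (hgv : ConvexE g)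
    (A : Matrix (Fin m) (Fin n) ℝ)
    (M1 : Matrix (Fin n) (Fin n) ℝ) (hM1 : M1.PosDef)
    (z : Fin m → ℝ) (y u : Fin n → ℝ)
    (hgrad : SubgradAt (conjE f) y (M1⁻¹.mulVec u))
    (L : (Fin m → ℝ) → (Fin n → ℝ) → (Fin n → ℝ) → EReal)
    (hL : ∀ zz yy uu, L zz yy uu = conjE g zz + conjE f yy +
      (((-(Aᵀ.mulVec zz) - yy) ⬝ᵥ M1⁻¹.mulVec uu +
        (1 / 2 : ℝ) * ((Aᵀ.mulVec zz + yy) ⬝ᵥ M1⁻¹.mulVec (Aᵀ.mulVec zz + yy)) : ℝ) : EReal)) :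
    conjE g z + conjE f (-(Aᵀ.mulVec z)) +
      (((1 / 2 : ℝ) * ((Aᵀ.mulVec z + y) ⬝ᵥ M1⁻¹.mulVec (Aᵀ.mulVec z + y)) -
        1 / (2 * μ) * ((Aᵀ.mulVec z + y) ⬝ᵥ (Aᵀ.mulVec z + y)) : ℝ) : EReal) ≤
      L z y u := by
  rw [hL, add_assoc, add_assoc]
  refine add_le_add le_rfl ?_
  by_cases hy : conjE f y = ⊤
  · rw [hy, EReal.top_add_coe]
    exact le_top
  obtain ⟨c, hc⟩ : ∃ c : ℝ, conjE f y = c :=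
    ⟨_, (EReal.coe_toReal hy (conjE_ne_bot hfp y)).symm⟩
  refine (add_le_add (hfsc.conjE_le_of_subgradAt hμ hfp.2 hc hgrad _) le_rfl).trans ?_
  rw [hc]
  norm_cast
  have hneg : -(Aᵀ.mulVec z) - y = -(Aᵀ.mulVec z + y) := by abel
  rw [hneg]
  simp only [neg_dotProduct, dotProduct_neg, neg_neg]
  linarith
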